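/- Let (A,B) be a random vector with nonnegative coordinates satisfying P(A=1)<1, P(B=0)<1, E A^κ = 1 and E B^κ < ∞ for some κ>0, and let U be the unique-in-law solution of U =_d A U + B with U independent of (A,B). Then E[(AU+B)^κ − (AU)^κ] is finite and strictly positive, and lim_{ε ↓ 0} E[(AU+B)^{κ−ε} − (AU)^{κ−ε}] = E[(AU+B)^κ − (AU)^κ]. -/

import Mathlib

open MeasureTheory ProbabilityTheory Filter Topology

open scoped ENNReal

section Perpetuity

variable {Ω : Type*} [MeasurableSpace Ω] {μ : Measure Ω}

/-- The `L^s` norm of `min (t * u) 1`. -/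
noncomputable def truncLpNorm (μ : Measure Ω) (s : ℝ) (u : Ω → ℝ≥0∞) (t : ℝ≥0∞) : ℝ≥0∞ :=
  (∫⁻ ω, min (t * u ω) 1 ^ s ∂μ) ^ (1 / s)

lemma truncLpNorm_rpow {s : ℝ} (hs : 0 < s) (u : Ω → ℝ≥0∞) (t : ℝ≥0∞) :
    truncLpNorm μ s u t ^ s = ∫⁻ ω, min (t * u ω) 1 ^ s ∂μ := by
  rw [truncLpNorm, ← ENNReal.rpow_mul, one_div, inv_mul_cancel₀ hs.ne', ENNReal.rpow_one]

lemma truncLpNorm_mono {s : ℝ} (hs : 0 < s) (u : Ω → ℝ≥0∞) : Monotone (truncLpNorm μ s u) := by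
  intro t t' h
  unfold truncLpNorm
  gcongr

lemma truncLpNorm_le_one [IsProbabilityMeasure μ] {s : ℝ} (hs : 0 < s) (u : Ω → ℝ≥0∞)
    (t : ℝ≥0∞) : truncLpNorm μ s u t ≤ 1 := by
  unfold truncLpNorm
  refine ENNReal.rpow_le_one ?_ (by positivity)
  calc ∫⁻ ω, min (t * u ω) 1 ^ s ∂μ ≤ ∫⁻ _, 1 ∂μ :=
        lintegral_mono fun ω => ENNReal.rpow_le_one (min_le_right _ _) hs.le
    _ = 1 := by simp

lemma tendsto_truncLpNorm_inv_nat [IsProbabilityMeasure μ] {s : ℝ} (hs : 0 < s)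
    {u : Ω → ℝ≥0∞} (hu : Measurable u) (hfin : ∀ ω, u ω ≠ ∞) :
    Tendsto (fun n : ℕ => truncLpNorm μ s u (n : ℝ≥0∞)⁻¹) atTop (𝓝 0) := by
  have h : Tendsto (fun n : ℕ => ∫⁻ ω, min ((n : ℝ≥0∞)⁻¹ * u ω) 1 ^ s ∂μ) atTop
      (𝓝 (∫⁻ _, 0 ∂μ)) := by
    refine tendsto_lintegral_of_dominated_convergence (fun _ => 1)
      (fun n => by fun_prop)
      (fun n => ae_of_all _ fun ω => ENNReal.rpow_le_one (min_le_right _ _) hs.le)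
      (by simp) (ae_of_all _ fun ω => ?_)
    have h1 : Tendsto (fun n : ℕ => (n : ℝ≥0∞)⁻¹ * u ω) atTop (𝓝 (0 * u ω)) :=
      ENNReal.Tendsto.mul_const ENNReal.tendsto_inv_nat_nhds_zero (Or.inr (hfin ω))
    have h2 := (ENNReal.continuous_rpow_const (y := s)).continuousAt.tendsto.comp
      (h1.min (tendsto_const_nhds (x := (1 : ℝ≥0∞))))
    simpa [Function.comp_def, ENNReal.zero_rpow_of_pos hs] using h2
  have h3 := (ENNReal.continuous_rpow_const (y := 1 / s)).continuousAt.tendsto.comp h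
  have hs' : 0 < 1 / s := by positivity
  rw [lintegral_zero, ENNReal.zero_rpow_of_pos hs'] at h3
  exact h3

lemma exists_truncLpNorm_le_add_mul [IsProbabilityMeasure μ] {s : ℝ} (hs : 0 < s)
    {u : Ω → ℝ≥0∞} (hu : Measurable u) (hfin : ∀ ω, u ω ≠ ∞) {δ : ℝ≥0∞} (hδ : 0 < δ) :
    ∃ K : ℝ≥0∞, K ≠ ∞ ∧ ∀ t, truncLpNorm μ s u t ≤ δ + K * t := by
  obtain ⟨n, hn, hn0⟩ := (((tendsto_truncLpNorm_inv_nat (μ := μ) hs hu hfin).eventually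
    (gt_mem_nhds hδ)).and (eventually_gt_atTop 0)).exists
  refine ⟨n, by simp, fun t => ?_⟩
  rcases le_total t (n : ℝ≥0∞)⁻¹ with h | h
  · exact ((truncLpNorm_mono hs u h).trans hn.le).trans le_self_add
  · refine (truncLpNorm_le_one hs u t).trans (le_trans ?_ le_add_self)
    rw [← ENNReal.mul_inv_cancel (a := (n : ℝ≥0∞)) (by exact_mod_cast hn0.ne') (by simp)]
    gcongr

lemma lintegral_min_mul_rpow_eq [IsProbabilityMeasure μ] {s : ℝ} (hs : 0 < s)
    {a u : Ω → ℝ≥0∞} (ha : Measurable a) (hu : Measurable u) (hind : IndepFun u a μ)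
    (t : ℝ≥0∞) :
    ∫⁻ ω, min (t * (a ω * u ω)) 1 ^ s ∂μ = ∫⁻ ω, truncLpNorm μ s u (t * a ω) ^ s ∂μ := by
  have hmap := (indepFun_iff_map_prod_eq_prod_map_map hu.aemeasurable ha.aemeasurable).1 hind
  have hm : Measurable fun p : ℝ≥0∞ × ℝ≥0∞ => min (t * (p.2 * p.1)) 1 ^ s := by fun_prop
  have : IsProbabilityMeasure (μ.map u) := Measure.isProbabilityMeasure_map hu.aemeasurable
  have : IsProbabilityMeasure (μ.map a) := Measure.isProbabilityMeasure_map ha.aemeasurable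
  calc ∫⁻ ω, min (t * (a ω * u ω)) 1 ^ s ∂μ
      = ∫⁻ p, min (t * (p.2 * p.1)) 1 ^ s ∂(μ.map fun ω => (u ω, a ω)) :=
        (lintegral_map hm (hu.prodMk ha)).symm
    _ = ∫⁻ y, ∫⁻ x, min (t * (y * x)) 1 ^ s ∂(μ.map u) ∂(μ.map a) := by
        rw [hmap, lintegral_prod_symm _ hm.aemeasurable]
    _ = ∫⁻ ω, ∫⁻ x, min (t * (a ω * x)) 1 ^ s ∂(μ.map u) ∂μ :=
        lintegral_map (hm.lintegral_prod_left' (μ := μ.map u)) ha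
    _ = _ := by
        refine lintegral_congr fun ω => ?_
        rw [truncLpNorm_rpow hs, lintegral_map (by fun_prop) hu]
        simp only [mul_assoc]

lemma truncLpNorm_le_of_fixedPoint [IsProbabilityMeasure μ] {s : ℝ} (hs : 1 ≤ s)
    {a b u : Ω → ℝ≥0∞} (ha : Measurable a) (hb : Measurable b) (hu : Measurable u)
    (hind : IndepFun u a μ) (hfix : μ.map u = μ.map fun ω => a ω * u ω + b ω)
    {δ K : ℝ≥0∞} (hK : ∀ t, truncLpNorm μ s u t ≤ δ + K * t) (t : ℝ≥0∞) :
    truncLpNorm μ s u t ≤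
      δ + (K * (∫⁻ ω, a ω ^ s ∂μ) ^ (1 / s) + (∫⁻ ω, b ω ^ s ∂μ) ^ (1 / s)) * t := by
  have hs0 : 0 < s := by linarith
  have hs0' : s ≠ 0 := hs0.ne'
  have hm : Measurable fun x : ℝ≥0∞ => min (t * x) 1 ^ s := by fun_prop
  have hconst : ∀ (f : Ω → ℝ≥0∞) (c : ℝ≥0∞), Measurable f →
      (∫⁻ ω, (c * f ω) ^ s ∂μ) ^ (1 / s) = c * (∫⁻ ω, f ω ^ s ∂μ) ^ (1 / s) := by
    intro f c hf
    simp_rw [ENNReal.mul_rpow_of_nonneg _ _ hs0.le]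
    rw [lintegral_const_mul _ (by fun_prop), ENNReal.mul_rpow_of_nonneg _ _ (by positivity),
      ← ENNReal.rpow_mul, mul_one_div_cancel hs0', ENNReal.rpow_one]
  calc truncLpNorm μ s u t
      = (∫⁻ ω, min (t * (a ω * u ω + b ω)) 1 ^ s ∂μ) ^ (1 / s) := by
        rw [truncLpNorm, ← lintegral_map hm hu, hfix, lintegral_map hm (by fun_prop)]
    _ ≤ (∫⁻ ω, ((fun ω => min (t * (a ω * u ω)) 1) + fun ω => t * b ω) ω ^ s ∂μ) ^ (1 / s) := by
        gcongr with ω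
        simp only [Pi.add_apply, mul_add]
        rw [min_add]
        exact min_le_min_left _ le_self_add
    _ ≤ (∫⁻ ω, min (t * (a ω * u ω)) 1 ^ s ∂μ) ^ (1 / s)
          + (∫⁻ ω, (t * b ω) ^ s ∂μ) ^ (1 / s) :=
        ENNReal.lintegral_Lp_add_le (by fun_prop) (by fun_prop) hs
    _ ≤ (∫⁻ ω, ((fun _ : Ω => δ) + fun ω => (K * t) * a ω) ω ^ s ∂μ) ^ (1 / s)
          + t * (∫⁻ ω, b ω ^ s ∂μ) ^ (1 / s) := by
        rw [hconst b t hb, lintegral_min_mul_rpow_eq hs0 ha hu hind]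
        gcongr with ω
        simpa [mul_assoc] using hK (t * a ω)
    _ ≤ ((∫⁻ _, δ ^ s ∂μ) ^ (1 / s) + (∫⁻ ω, ((K * t) * a ω) ^ s ∂μ) ^ (1 / s))
          + t * (∫⁻ ω, b ω ^ s ∂μ) ^ (1 / s) := by
        gcongr
        exact ENNReal.lintegral_Lp_add_le (by fun_prop) (by fun_prop) hs
    _ = _ := by
        rw [hconst a _ ha, lintegral_const, measure_univ, mul_one, ← ENNReal.rpow_mul,
          mul_one_div_cancel hs0', ENNReal.rpow_one]
        ring

/-- A solution of `U = A U + B` in law has a finite moment of every order `s ≥ 1` for which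
`E A^s < 1` and `E B^s < ∞`. -/
theorem lintegral_rpow_ne_top_of_fixedPoint [IsProbabilityMeasure μ] {s : ℝ} (hs : 1 ≤ s)
    {a b u : Ω → ℝ≥0∞} (ha : Measurable a) (hb : Measurable b) (hu : Measurable u)
    (hfin : ∀ ω, u ω ≠ ∞) (hind : IndepFun u a μ)
    (hfix : μ.map u = μ.map fun ω => a ω * u ω + b ω)
    (has : ∫⁻ ω, a ω ^ s ∂μ < 1) (hbs : ∫⁻ ω, b ω ^ s ∂μ ≠ ∞) :
    ∫⁻ ω, u ω ^ s ∂μ ≠ ∞ := by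
  have hs0 : 0 < s := by linarith
  set ρ := (∫⁻ ω, a ω ^ s ∂μ) ^ (1 / s)
  set c := (∫⁻ ω, b ω ^ s ∂μ) ^ (1 / s)
  have hρ1 : ρ < 1 := ENNReal.rpow_lt_one has (by positivity)
  have hc_fin : c ≠ ∞ := ENNReal.rpow_ne_top_of_nonneg (by positivity) hbs
  have h1ρ : 1 - ρ ≠ 0 := (tsub_pos_of_lt hρ1).ne'
  set C := c * (1 - ρ)⁻¹ with hC
  have hC_fin : C ≠ ∞ := ENNReal.mul_ne_top hc_fin (ENNReal.inv_ne_top.2 h1ρ)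
  have hCeq : C * ρ + c = C := by
    have h1 : c = C * (1 - ρ) := by
      rw [hC, mul_assoc, ENNReal.inv_mul_cancel h1ρ (by finiteness), mul_one]
    conv_lhs => rw [h1]
    rw [← mul_add, add_tsub_cancel_of_le hρ1.le, mul_one]
  have hlin : ∀ t, t ≠ ∞ → truncLpNorm μ s u t ≤ C * t := by
    intro t ht
    refine ENNReal.le_of_forall_pos_le_add fun δ hδ _ => ?_
    obtain ⟨K, hK_fin, hK⟩ := exists_truncLpNorm_le_add_mul (μ := μ) hs0 hu hfin
      (ENNReal.coe_pos.2 hδ)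
    have hiter : ∀ n : ℕ, ∀ t, truncLpNorm μ s u t ≤ δ + (K * ρ ^ n + C) * t := by
      intro n
      induction n with
      | zero =>
        intro t
        refine (hK t).trans ?_
        gcongr
        simp
      | succ n ih =>
        intro t
        have hstep : (K * ρ ^ n + C) * ρ + c = K * ρ ^ (n + 1) + C := by
          rw [add_mul, add_assoc, hCeq, pow_succ, mul_assoc]
        rw [← hstep]
        exact truncLpNorm_le_of_fixedPoint hs ha hb hu hind hfix ih t
    have hlim : Tendsto (fun n : ℕ => δ + (K * ρ ^ n + C) * t) atTop
        (𝓝 (δ + (K * 0 + C) * t)) :=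
      tendsto_const_nhds.add (ENNReal.Tendsto.mul_const
        ((ENNReal.Tendsto.const_mul (ENNReal.tendsto_pow_atTop_nhds_zero_of_lt_one hρ1)
          (Or.inr hK_fin)).add tendsto_const_nhds) (Or.inr ht))
    have := ge_of_tendsto' hlim fun n => hiter n t
    rwa [mul_zero, zero_add, add_comm] at this
  have hmin : ∀ n : ℕ, ∫⁻ ω, min (u ω) (n + 1 : ℕ) ^ s ∂μ ≤ C ^ s := by
    intro n
    have hn0 : ((n + 1 : ℕ) : ℝ≥0∞) ≠ 0 := by exact_mod_cast n.succ_ne_zero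
    have hnt : ((n + 1 : ℕ) : ℝ≥0∞) ≠ ∞ := by finiteness
    generalize ((n + 1 : ℕ) : ℝ≥0∞) = m at hn0 hnt
    have hm : ∀ ω, min (u ω) m ^ s = m ^ s * min (m⁻¹ * u ω) 1 ^ s := by
      intro ω
      rw [← ENNReal.mul_rpow_of_nonneg _ _ hs0.le, mul_min, ← mul_assoc,
        ENNReal.mul_inv_cancel hn0 hnt, one_mul, mul_one]
    simp_rw [hm]
    rw [lintegral_const_mul _ (by fun_prop), ← truncLpNorm_rpow hs0,
      ← ENNReal.mul_rpow_of_nonneg _ _ hs0.le]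
    gcongr
    calc m * truncLpNorm μ s u m⁻¹ ≤ m * (C * m⁻¹) := by
          gcongr
          exact hlin _ (ENNReal.inv_ne_top.2 hn0)
      _ = C := by rw [mul_left_comm, ENNReal.mul_inv_cancel hn0 hnt, mul_one]
  have hfatou := lintegral_liminf_le (μ := μ) (u := atTop)
    (f := fun (n : ℕ) ω => min (u ω) (n + 1 : ℕ) ^ s) (fun n => by fun_prop)
  have hpt : ∀ ω, liminf (fun n : ℕ => min (u ω) (n + 1 : ℕ) ^ s) atTop = u ω ^ s := by
    intro ω
    refine Tendsto.liminf_eq ?_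
    have h1 : Tendsto (fun n : ℕ => min (u ω) ((n + 1 : ℕ) : ℝ≥0∞)) atTop (𝓝 (min (u ω) ∞)) :=
      tendsto_const_nhds.min (ENNReal.tendsto_nat_nhds_top.comp (tendsto_add_atTop_nat 1))
    simpa [Function.comp_def] using
      (ENNReal.continuous_rpow_const (y := s)).continuousAt.tendsto.comp h1
  simp_rw [hpt] at hfatou
  refine ne_top_of_le_ne_top (ENNReal.rpow_ne_top_of_nonneg hs0.le hC_fin) (hfatou.trans ?_)
  exact (liminf_le_liminf (Eventually.of_forall hmin)).trans_eq (by simp)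

end Perpetuity

section Moments

variable {Ω : Type*} [MeasurableSpace Ω] {μ : Measure Ω}

lemma rpow_le_one_add_rpow {x s κ : ℝ} (hx : 0 ≤ x) (hs : 0 ≤ s) (hsκ : s ≤ κ) :
    x ^ s ≤ 1 + x ^ κ := by
  rcases le_total x 1 with h | h
  · linarith [Real.rpow_le_one hx h hs, Real.rpow_nonneg hx κ]
  · linarith [Real.rpow_le_rpow_of_exponent_le h hsκ]

lemma integrable_rpow_of_le [IsFiniteMeasure μ] {X : Ω → ℝ} (hX : Measurable X)
    (hX0 : ∀ᵐ ω ∂μ, 0 ≤ X ω) {s κ : ℝ} (hs : 0 ≤ s) (hsκ : s ≤ κ)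
    (hint : Integrable (fun ω => X ω ^ κ) μ) : Integrable (fun ω => X ω ^ s) μ := by
  refine ((integrable_const (1 : ℝ)).add hint).mono'
    (by fun_prop : Measurable fun ω => X ω ^ s).aestronglyMeasurable ?_
  filter_upwards [hX0] with ω hω
  rw [Real.norm_of_nonneg (Real.rpow_nonneg hω s)]
  exact rpow_le_one_add_rpow hω hs hsκ

/-- Moments of order below `κ` are below one when the `κ`-th moment equals one. -/
lemma integral_rpow_lt_one [IsProbabilityMeasure μ] {A : Ω → ℝ} (hA : Measurable A)
    (hA0 : ∀ ω, 0 ≤ A ω) (hA1 : μ {ω | A ω = 1} < 1) {s κ : ℝ} (hs : 0 < s) (hsκ : s < κ)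
    (hint : Integrable (fun ω => A ω ^ κ) μ) (hAκ : ∫ ω, A ω ^ κ ∂μ = 1) :
    ∫ ω, A ω ^ s ∂μ < 1 := by
  have hκ : 0 < κ := hs.trans hsκ
  have hstrict : ∀ ω, A ω ≠ 1 → A ω ^ s < 1 + s / κ * (A ω ^ κ - 1) := by
    intro ω hω
    have hne : A ω ^ κ - 1 ≠ 0 := by
      intro h
      exact hω ((Real.rpow_left_inj (hA0 ω) zero_le_one hκ.ne').1 (by rw [Real.one_rpow]; linarith))
    have h := rpow_one_add_lt_one_add_mul_self
      (by linarith [Real.rpow_nonneg (hA0 ω) κ] : -1 ≤ A ω ^ κ - 1) hne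
      (div_pos hs hκ) ((div_lt_one hκ).2 hsκ)
    rwa [add_sub_cancel, ← Real.rpow_mul (hA0 ω), mul_div_cancel₀ _ hκ.ne'] at h
  have hints : Integrable (fun ω => A ω ^ s) μ :=
    integrable_rpow_of_le hA (ae_of_all _ hA0) hs.le hsκ.le hint
  have hints1 : Integrable (fun ω => A ω ^ κ - 1) μ := hint.sub (integrable_const _)
  have hintr : Integrable (fun ω => 1 + s / κ * (A ω ^ κ - 1)) μ :=
    (integrable_const _).add (hints1.const_mul _)
  have hr : ∫ ω, (1 + s / κ * (A ω ^ κ - 1)) ∂μ = 1 := by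
    rw [integral_add (integrable_const _) (hints1.const_mul _),
      integral_const_mul, integral_sub hint (integrable_const _), hAκ]
    simp
  have hdiff : Integrable (fun ω => (1 + s / κ * (A ω ^ κ - 1)) - A ω ^ s) μ := hintr.sub hints
  have hpos : 0 < ∫ ω, ((1 + s / κ * (A ω ^ κ - 1)) - A ω ^ s) ∂μ := by
    rw [integral_pos_iff_support_of_nonneg_ae (ae_of_all _ fun ω => ?_) hdiff]
    · have hsub : {ω | A ω = 1}ᶜ ⊆
          Function.support fun ω => (1 + s / κ * (A ω ^ κ - 1)) - A ω ^ s :=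
        fun ω hω => (sub_pos.2 (hstrict ω hω)).ne'
      refine lt_of_lt_of_le ?_ (measure_mono hsub)
      rw [prob_compl_eq_one_sub (measurableSet_eq_fun hA measurable_const)]
      exact tsub_pos_of_lt hA1
    · by_cases h : A ω = 1
      · simp [h]
      · exact sub_nonneg.2 (hstrict ω h).le
  rw [integral_sub hintr hints, hr] at hpos
  linarith

lemma lintegral_ofReal_rpow_eq {X : Ω → ℝ} (hX0 : ∀ ω, 0 ≤ X ω) {s : ℝ} (hs : 0 ≤ s)
    (hint : Integrable (fun ω => X ω ^ s) μ) :
    ∫⁻ ω, ENNReal.ofReal (X ω) ^ s ∂μ = ENNReal.ofReal (∫ ω, X ω ^ s ∂μ) := by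
  rw [ofReal_integral_eq_lintegral_ofReal hint
    (ae_of_all _ fun ω => Real.rpow_nonneg (hX0 ω) s)]
  exact lintegral_congr fun ω => ENNReal.ofReal_rpow_of_nonneg (hX0 ω) hs

lemma integrable_rpow_of_fixedPoint [IsProbabilityMeasure μ] {A B U : Ω → ℝ} {κ s : ℝ}
    (hA : Measurable A) (hB : Measurable B) (hU : Measurable U)
    (hA0 : ∀ ω, 0 ≤ A ω) (hB0 : ∀ ω, 0 ≤ B ω) (hU0 : ∀ᵐ ω ∂μ, 0 ≤ U ω)
    (hA1 : μ {ω | A ω = 1} < 1)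
    (hAint : Integrable (fun ω => A ω ^ κ) μ) (hAκ : ∫ ω, A ω ^ κ ∂μ = 1)
    (hBint : Integrable (fun ω => B ω ^ κ) μ)
    (hindep : IndepFun U (fun ω => (A ω, B ω)) μ)
    (hfix : μ.map U = μ.map fun ω => A ω * U ω + B ω) (hs : 1 ≤ s) (hsκ : s < κ) :
    Integrable (fun ω => U ω ^ s) μ := by
  have hs0 : 0 < s := by linarith
  have hind : IndepFun (fun ω => ENNReal.ofReal (U ω)) (fun ω => ENNReal.ofReal (A ω)) μ :=
    hindep.comp ENNReal.measurable_ofReal (ENNReal.measurable_ofReal.comp measurable_fst)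
  have hfix' : μ.map (fun ω => ENNReal.ofReal (U ω)) = μ.map fun ω =>
      ENNReal.ofReal (A ω) * ENNReal.ofReal (U ω) + ENNReal.ofReal (B ω) := by
    have h := congrArg (Measure.map ENNReal.ofReal) hfix
    rw [Measure.map_map ENNReal.measurable_ofReal hU,
      Measure.map_map ENNReal.measurable_ofReal (by fun_prop)] at h
    refine h.trans (Measure.map_congr ?_)
    filter_upwards [hU0] with ω hω
    rw [Function.comp_apply, ENNReal.ofReal_add (mul_nonneg (hA0 ω) hω) (hB0 ω),
      ENNReal.ofReal_mul (hA0 ω)]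
  have hAs := integrable_rpow_of_le hA (ae_of_all _ hA0) hs0.le hsκ.le hAint
  have hBs := integrable_rpow_of_le hB (ae_of_all _ hB0) hs0.le hsκ.le hBint
  have hfinite := lintegral_rpow_ne_top_of_fixedPoint hs hA.ennreal_ofReal hB.ennreal_ofReal
    hU.ennreal_ofReal (fun _ => ENNReal.ofReal_ne_top) hind hfix'
    (by
      rw [lintegral_ofReal_rpow_eq hA0 hs0.le hAs, ENNReal.ofReal_lt_one]
      exact integral_rpow_lt_one hA hA0 hA1 hs0 hsκ hAint hAκ)
    (by
      rw [lintegral_ofReal_rpow_eq hB0 hs0.le hBs]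
      exact ENNReal.ofReal_ne_top)
  refine ⟨(by fun_prop : Measurable fun ω => U ω ^ s).aestronglyMeasurable, ?_⟩
  rw [hasFiniteIntegral_iff_ofReal (hU0.mono fun ω hω => Real.rpow_nonneg hω s)]
  refine lt_of_le_of_lt (le_of_eq (lintegral_congr_ae ?_)) hfinite.lt_top
  filter_upwards [hU0] with ω hω
  exact (ENNReal.ofReal_rpow_of_nonneg hω hs0.le).symm

lemma add_rpow_sub_rpow_le_of_le_one {x y s κ : ℝ} (hx : 0 ≤ x) (hy : 0 ≤ y) (hs : 0 ≤ s)
    (hsκ : s ≤ κ) (hκ : κ ≤ 1) : (x + y) ^ s - x ^ s ≤ 1 + y ^ κ := by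
  linarith [Real.rpow_add_le_add_rpow hx hy hs (hsκ.trans hκ), rpow_le_one_add_rpow hy hs hsκ]

lemma add_rpow_sub_rpow_le {x y s : ℝ} (hx : 0 ≤ x) (hy : 0 ≤ y) (hs : 1 ≤ s) :
    (x + y) ^ s - x ^ s ≤ s * y * (x + y) ^ (s - 1) := by
  rcases (add_nonneg hx hy).eq_or_lt with h | h
  · have hx' : x = 0 := by linarith
    have hy' : y = 0 := by linarith
    simp [hx', hy']
  · have hb := one_add_mul_self_le_rpow_one_add
      (by rw [neg_le_neg_iff, div_le_one h]; linarith : -1 ≤ -(y / (x + y))) hs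
    have hsum : 1 + -(y / (x + y)) = x / (x + y) := by field_simp; ring
    rw [hsum, Real.div_rpow hx h.le, le_div_iff₀ (Real.rpow_pos_of_pos h s)] at hb
    have hpow : (x + y) ^ s = (x + y) ^ (s - 1) * (x + y) := by
      rw [← Real.rpow_add_one h.ne', sub_add_cancel]
    have hexp : (1 + s * -(y / (x + y))) * (x + y) ^ s
        = (x + y) ^ s - s * y * (x + y) ^ (s - 1) := by
      rw [hpow]; field_simp; ring
    linarith

lemma add_rpow_le_two_rpow_mul {x y p : ℝ} (hx : 0 ≤ x) (hy : 0 ≤ y) (hp : 0 ≤ p) :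
    (x + y) ^ p ≤ 2 ^ p * (x ^ p + y ^ p) := by
  have key : ∀ z, 0 ≤ z → x + y ≤ 2 * z → (x + y) ^ p ≤ 2 ^ p * z ^ p := fun z hz h => by
    rw [← Real.mul_rpow (by norm_num) hz]
    exact Real.rpow_le_rpow (by linarith) h hp
  have h2 : (0 : ℝ) ≤ 2 ^ p := by positivity
  rcases le_total x y with h | h
  · refine (key y hy (by linarith)).trans (mul_le_mul_of_nonneg_left ?_ h2)
    linarith [Real.rpow_nonneg hx p]
  · refine (key x hx (by linarith)).trans (mul_le_mul_of_nonneg_left ?_ h2)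
    linarith [Real.rpow_nonneg hy p]

lemma mul_rpow_sub_one_le {a b κ : ℝ} (ha : 0 ≤ a) (hb : 0 ≤ b) (hκ : 1 < κ) :
    b * a ^ (κ - 1) ≤ a ^ κ + b ^ κ := by
  have key : ∀ z : ℝ, 0 ≤ z → z * z ^ (κ - 1) = z ^ κ := fun z hz => by
    rw [mul_comm, ← Real.rpow_add_one' hz (by linarith), sub_add_cancel]
  have hap := Real.rpow_nonneg ha κ
  have hbp := Real.rpow_nonneg hb κ
  rcases le_total a b with h | h
  · calc b * a ^ (κ - 1) ≤ b * b ^ (κ - 1) := by gcongr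
      _ ≤ _ := by rw [key b hb]; linarith
  · calc b * a ^ (κ - 1) ≤ a * a ^ (κ - 1) := by gcongr
      _ ≤ _ := by rw [key a ha]; linarith

lemma mul_add_rpow_sub_rpow_le {a b u s κ : ℝ} (ha : 0 ≤ a) (hb : 0 ≤ b) (hu : 0 ≤ u)
    (hs : 1 ≤ s) (hsκ : s ≤ κ) (hκ : 1 < κ) :
    (a * u + b) ^ s - (a * u) ^ s ≤
      κ * ((1 + b ^ κ) + 2 ^ (κ - 1) * (u ^ (κ - 1) * (a ^ κ + b ^ κ) + b ^ κ)) := by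
  have hau : 0 ≤ a * u := mul_nonneg ha hu
  have hz : 0 ≤ a * u + b := add_nonneg hau hb
  have hbκ : b * b ^ (κ - 1) = b ^ κ := by
    rw [mul_comm, ← Real.rpow_add_one' hb (by linarith), sub_add_cancel]
  have hb1 : b ≤ 1 + b ^ κ := by
    simpa using rpow_le_one_add_rpow hb zero_le_one hκ.le
  calc (a * u + b) ^ s - (a * u) ^ s
      ≤ s * b * (a * u + b) ^ (s - 1) := add_rpow_sub_rpow_le hau hb hs
    _ ≤ κ * b * (1 + (a * u + b) ^ (κ - 1)) := by
        gcongr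
        exact rpow_le_one_add_rpow hz (by linarith) (by linarith)
    _ ≤ κ * b * (1 + 2 ^ (κ - 1) * ((a * u) ^ (κ - 1) + b ^ (κ - 1))) := by
        gcongr
        exact add_rpow_le_two_rpow_mul hau hb (by linarith)
    _ = κ * (b + 2 ^ (κ - 1) * (u ^ (κ - 1) * (b * a ^ (κ - 1)) + b ^ κ)) := by
        rw [Real.mul_rpow ha hu, ← hbκ]; ring
    _ ≤ _ := by
        gcongr
        exact mul_rpow_sub_one_le ha hb hκ

end Moments

/-- `E[(AU+B)^κ − (AU)^κ]` is finite and strictly positive, and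
`E[(AU+B)^{κ−ε} − (AU)^{κ−ε}] → E[(AU+B)^κ − (AU)^κ]` as `ε ↓ 0`. -/
theorem limit_of_difference_moments
    {Ω : Type*} [MeasurableSpace Ω] (μ : Measure Ω) [IsProbabilityMeasure μ]
    (A B U : Ω → ℝ) (κ : ℝ)
    (hA : Measurable A) (hB : Measurable B) (hU : Measurable U)
    (hA0 : ∀ ω, 0 ≤ A ω) (hB0 : ∀ ω, 0 ≤ B ω) (hU0 : ∀ᵐ ω ∂μ, 0 ≤ U ω)
    (hκ : 0 < κ)
    (hAne1 : μ {ω | A ω = 1} < 1)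
    (hBne0 : μ {ω | B ω = 0} < 1)
    (hAκint : Integrable (fun ω => A ω ^ κ) μ)
    (hAκ : ∫ ω, A ω ^ κ ∂μ = 1)
    (hBκ : Integrable (fun ω => B ω ^ κ) μ)
    (hindep : IndepFun U (fun ω => (A ω, B ω)) μ)
    (hfix : Measure.map U μ = Measure.map (fun ω => A ω * U ω + B ω) μ) :
    Integrable (fun ω => (A ω * U ω + B ω) ^ κ - (A ω * U ω) ^ κ) μ ∧
    0 < ∫ ω, ((A ω * U ω + B ω) ^ κ - (A ω * U ω) ^ κ) ∂μ ∧
    Filter.Tendsto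
      (fun ε : ℝ =>
        ∫ ω, ((A ω * U ω + B ω) ^ (κ - ε) - (A ω * U ω) ^ (κ - ε)) ∂μ)
      (nhdsWithin 0 (Set.Ioi 0))
      (nhds (∫ ω, ((A ω * U ω + B ω) ^ κ - (A ω * U ω) ^ κ) ∂μ)) := by
  have hindκ : IndepFun (fun ω => U ω ^ (κ - 1)) (fun ω => A ω ^ κ + B ω ^ κ) μ :=
    hindep.comp (φ := fun x : ℝ => x ^ (κ - 1)) (ψ := fun p : ℝ × ℝ => p.1 ^ κ + p.2 ^ κ)
      (by fun_prop) (by fun_prop)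
  have hbound : ∃ G : Ω → ℝ, Integrable G μ ∧ ∃ r, 0 < r ∧ r < κ ∧
      ∀ s, r < s → s ≤ κ → ∀ᵐ ω ∂μ, (A ω * U ω + B ω) ^ s - (A ω * U ω) ^ s ≤ G ω := by
    rcases le_or_gt κ 1 with h1 | h1
    · refine ⟨_, (integrable_const (1 : ℝ)).add hBκ, κ / 2, by linarith, by linarith,
        fun s hs hsκ => ?_⟩
      filter_upwards [hU0] with ω hω
      exact add_rpow_sub_rpow_le_of_le_one (mul_nonneg (hA0 ω) hω) (hB0 ω) (by linarith) hsκ h1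
    · have hUint : Integrable (fun ω => U ω ^ (κ - 1)) μ :=
        integrable_rpow_of_le hU hU0 (by linarith) (le_max_right 1 (κ - 1))
          (integrable_rpow_of_fixedPoint hA hB hU hA0 hB0 hU0 hAne1 hAκint hAκ hBκ hindep hfix
            (le_max_left 1 (κ - 1)) (max_lt h1 (by linarith)))
      have hprod : Integrable (fun ω => U ω ^ (κ - 1) * (A ω ^ κ + B ω ^ κ)) μ :=
        hindκ.integrable_mul hUint (hAκint.add hBκ)
      refine ⟨_, (((integrable_const (1 : ℝ)).add hBκ).add
        ((hprod.add hBκ).const_mul (2 ^ (κ - 1)))).const_mul κ, 1, one_pos, h1,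
        fun s hs hsκ => ?_⟩
      filter_upwards [hU0] with ω hω
      exact mul_add_rpow_sub_rpow_le (hA0 ω) (hB0 ω) hω hs.le hsκ h1
  obtain ⟨G, hG, r, hr, hrκ, hle⟩ := hbound
  have hmeas : ∀ s : ℝ, AEStronglyMeasurable
      (fun ω => (A ω * U ω + B ω) ^ s - (A ω * U ω) ^ s) μ := fun s =>
    (by fun_prop : Measurable fun ω =>
      (A ω * U ω + B ω) ^ s - (A ω * U ω) ^ s).aestronglyMeasurable
  have hnonneg : ∀ s : ℝ, 0 ≤ s → ∀ᵐ ω ∂μ,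
      0 ≤ (A ω * U ω + B ω) ^ s - (A ω * U ω) ^ s := by
    intro s hs
    filter_upwards [hU0] with ω hω
    exact sub_nonneg.2 (Real.rpow_le_rpow (mul_nonneg (hA0 ω) hω) (by linarith [hB0 ω]) hs)
  have hnorm : ∀ s, r < s → s ≤ κ → ∀ᵐ ω ∂μ,
      ‖(A ω * U ω + B ω) ^ s - (A ω * U ω) ^ s‖ ≤ G ω := by
    intro s hs hsκ
    filter_upwards [hle s hs hsκ, hnonneg s (by linarith)] with ω h1 h2
    rwa [Real.norm_of_nonneg h2]
  have hint := hG.mono' (hmeas κ) (hnorm κ hrκ le_rfl)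
  refine ⟨hint, ?_, ?_⟩
  · rw [integral_pos_iff_support_of_nonneg_ae (hnonneg κ hκ.le) hint]
    have hBpos : 0 < μ {ω | B ω = 0}ᶜ := by
      rw [prob_compl_eq_one_sub (measurableSet_eq_fun hB measurable_const)]
      exact tsub_pos_of_lt hBne0
    refine hBpos.trans_le (measure_mono_ae ?_)
    filter_upwards [hU0] with ω hω hBω
    have hBω' : 0 < B ω := lt_of_le_of_ne (hB0 ω) (Ne.symm hBω)
    exact (sub_pos.2 (Real.rpow_lt_rpow (mul_nonneg (hA0 ω) hω) (by linarith) hκ)).ne'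
  · have hev : ∀ᶠ ε : ℝ in 𝓝[>] 0, r < κ - ε ∧ κ - ε ≤ κ := by
      filter_upwards [Ioo_mem_nhdsGT (sub_pos.2 hrκ)] with ε hε
      constructor <;> linarith [hε.1, hε.2]
    refine tendsto_integral_filter_of_dominated_convergence G
      (Eventually.of_forall fun ε => hmeas (κ - ε))
      (hev.mono fun ε hε => hnorm _ hε.1 hε.2) hG (ae_of_all _ fun ω => ?_)
    have hexp : Tendsto (fun ε : ℝ => κ - ε) (𝓝[>] 0) (𝓝 κ) := by
      have : Tendsto (fun ε : ℝ => κ - ε) (𝓝 0) (𝓝 (κ - 0)) := tendsto_const_nhds.sub tendsto_id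
      rw [sub_zero] at this
      exact this.mono_left nhdsWithin_le_nhds
    have hpow : ∀ x : ℝ, Tendsto (fun ε : ℝ => x ^ (κ - ε)) (𝓝[>] 0) (𝓝 (x ^ κ)) := fun x =>
      (Real.continuousAt_const_rpow' hκ.ne').tendsto.comp hexp
    exact (hpow _).sub (hpow _)
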